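/- Tame approximation of symplectomorphisms: let K be a field of characteristic zero and n ≥ 1. Let σ be a K-algebra automorphism of K[x_1,…,x_n,p_1,…,p_n] which preserves the canonical Poisson bracket (σ({f,g}) = {σ(f),σ(g)} for all f,g) and is origin-preserving (each σ(x_i) and each σ(p_i) has zero constant term). Let TSymp be the subgroup of Aut_K(K[x_1,…,x_n,p_1,…,p_n]) generated by all bracket-preserving automorphisms that are either linear or origin-preserving elementary. Then for every k ∈ ℕ there exists τ ∈ TSymp such that for every generator ξ ∈ {x_1,…,x_n,p_1,…,p_n}, the polynomial (τ^{-1}∘σ)(ξ) − ξ has height ≥ k. -/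

import Mathlib

open MvPolynomial

/-- The canonical Poisson bracket on `K[x_1,…,x_n,p_1,…,p_n]`:
`{f,g} = ∑_i (∂f/∂x_i·∂g/∂p_i − ∂f/∂p_i·∂g/∂x_i)`. -/
noncomputable def poissonBracket {K : Type*} [Field K] {n : ℕ}
    (f g : MvPolynomial (Fin n ⊕ Fin n) K) : MvPolynomial (Fin n ⊕ Fin n) K :=
  ∑ i : Fin n,
    (pderiv (Sum.inl i) f * pderiv (Sum.inr i) g -
      pderiv (Sum.inr i) f * pderiv (Sum.inl i) g)

/-- An automorphism is linear if the image of every generator is a `K`-linear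
combination of the generators. -/
def IsLinearAut {K : Type*} [Field K] {n : ℕ}
    (e : MvPolynomial (Fin n ⊕ Fin n) K ≃ₐ[K] MvPolynomial (Fin n ⊕ Fin n) K) : Prop :=
  ∀ v : Fin n ⊕ Fin n,
    e (X v) ∈ Submodule.span K
      (Set.range (X : (Fin n ⊕ Fin n) → MvPolynomial (Fin n ⊕ Fin n) K))

/-- An automorphism is origin-preserving elementary if it sends one generator
`ξ_m ↦ a·ξ_m + f`, with `a ≠ 0` and `f` a polynomial with zero constant term in the
remaining generators, and fixes all other generators. -/
def IsOriginPresElementaryAut {K : Type*} [Field K] {n : ℕ}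
    (e : MvPolynomial (Fin n ⊕ Fin n) K ≃ₐ[K] MvPolynomial (Fin n ⊕ Fin n) K) : Prop :=
  ∃ (m : Fin n ⊕ Fin n) (a : K) (f : MvPolynomial (Fin n ⊕ Fin n) K),
    a ≠ 0 ∧
    f ∈ Algebra.adjoin K (X '' {j : Fin n ⊕ Fin n | j ≠ m}) ∧
    constantCoeff f = 0 ∧
    e (X m) = C a * X m + f ∧
    ∀ j : Fin n ⊕ Fin n, j ≠ m → e (X j) = X j

/-- A polynomial `h` has height `≥ k` if every monomial occurring in `h` with nonzero
coefficient has total degree `≥ k`. -/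
def HeightGE {K : Type*} [Field K] {n : ℕ}
    (h : MvPolynomial (Fin n ⊕ Fin n) K) (k : ℕ) : Prop :=
  ∀ d ∈ h.support, k ≤ d.sum fun _ e => e


namespace TameSymp

/-- The polynomial algebra in the canonical coordinates. -/
abbrev Poly (n : ℕ) (K : Type*) [Field K] := MvPolynomial (Fin n ⊕ Fin n) K

/-- The ideal of polynomials without constant term. -/
noncomputable abbrev mm (n : ℕ) (K : Type*) [Field K] : Ideal (Poly n K) :=
  idealOfVars (Fin n ⊕ Fin n) K

variable {K : Type*} [Field K] {n : ℕ}

/-- The Poisson bracket with `f` as a derivation. -/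
noncomputable def pbD (f : Poly n K) : Derivation K (Poly n K) (Poly n K) :=
  ∑ i : Fin n, (pderiv (Sum.inl i) f • pderiv (Sum.inr i) -
    pderiv (Sum.inr i) f • pderiv (Sum.inl i))

theorem pbD_apply (f g : Poly n K) : pbD f g = poissonBracket f g := by
  rw [pbD, ← Derivation.coeFnAddMonoidHom_apply, map_sum, Finset.sum_apply]
  simp [poissonBracket]

theorem pb_add_right (f g h : Poly n K) :
    poissonBracket f (g + h) = poissonBracket f g + poissonBracket f h := by
  simp [← pbD_apply]

theorem pb_sub_right (f g h : Poly n K) :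
    poissonBracket f (g - h) = poissonBracket f g - poissonBracket f h := by
  simp [← pbD_apply]

theorem pb_mul_right (f g h : Poly n K) :
    poissonBracket f (g * h) = g * poissonBracket f h + h * poissonBracket f g := by
  simp [← pbD_apply]

theorem pb_C_right (f : Poly n K) (c : K) : poissonBracket f (C c) = 0 := by
  simp [poissonBracket]

theorem pb_swap (f g : Poly n K) : poissonBracket f g = - poissonBracket g f := by
  simp only [poissonBracket, ← Finset.sum_neg_distrib]
  refine Finset.sum_congr rfl fun i _ => ?_
  ring

theorem pb_add_left (f g h : Poly n K) :
    poissonBracket (f + g) h = poissonBracket f h + poissonBracket g h := by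
  rw [pb_swap, pb_add_right, pb_swap f, pb_swap g]; ring

theorem pb_sub_left (f g h : Poly n K) :
    poissonBracket (f - g) h = poissonBracket f h - poissonBracket g h := by
  rw [pb_swap, pb_sub_right, pb_swap f, pb_swap g]; ring

theorem pb_C_left (f : Poly n K) (c : K) : poissonBracket (C c) f = 0 := by
  simp [poissonBracket]

theorem pb_mul_left (f g h : Poly n K) :
    poissonBracket (f * g) h = f * poissonBracket g h + g * poissonBracket f h := by
  rw [pb_swap, pb_mul_right, pb_swap f, pb_swap g]; ring

theorem pb_pow_right (f g : Poly n K) (d : ℕ) :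
    poissonBracket f (g ^ (d + 1)) = C ((d : K) + 1) * g ^ d * poissonBracket f g := by
  rw [← pbD_apply, Derivation.leibniz_pow, pbD_apply]
  simp [mul_assoc]

theorem pb_self (f : Poly n K) : poissonBracket f f = 0 := by
  simp only [poissonBracket]
  refine Finset.sum_eq_zero fun i _ => ?_
  ring

/-- The sign of a coordinate. -/
def sg (K : Type*) [Field K] : Fin n ⊕ Fin n → K := Sum.elim (fun _ => 1) (fun _ => -1)

theorem sg_mul_self (v : Fin n ⊕ Fin n) : sg K v * sg K v = 1 := by
  rcases v with i | i <;> simp [sg]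

theorem sg_swap (v : Fin n ⊕ Fin n) : sg K v.swap = - sg K v := by
  rcases v with i | i <;> simp [sg]

theorem pb_X_left (v : Fin n ⊕ Fin n) (f : Poly n K) :
    poissonBracket (X v) f = C (sg K v) * pderiv v.swap f := by
  classical
  rcases v with i | i <;> simp [poissonBracket, sg, pderiv_X, Pi.single_apply]

theorem pb_X_right (v : Fin n ⊕ Fin n) (f : Poly n K) :
    poissonBracket f (X v) = - (C (sg K v) * pderiv v.swap f) := by
  rw [pb_swap, pb_X_left]

theorem pb_X_X (v w : Fin n ⊕ Fin n) : ∃ c : K, poissonBracket (X v) (X w : Poly n K) = C c := by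
  classical
  rw [pb_X_left, pderiv_X, Pi.single_apply]
  split_ifs
  · exact ⟨sg K v, by simp⟩
  · exact ⟨0, by simp⟩

/-- Bracket preservation can be tested on generators. -/
theorem pb_preserve (e : Poly n K →ₐ[K] Poly n K)
    (h : ∀ v w, poissonBracket (e (X v)) (e (X w)) = e (poissonBracket (X v) (X w))) (f g) :
    e (poissonBracket f g) = poissonBracket (e f) (e g) := by
  have h1 : ∀ v g, e (poissonBracket (X v) g) = poissonBracket (e (X v)) (e g) := by
    intro v g
    induction g using MvPolynomial.induction_on with
    | C a => simp [pb_C_right, ← algebraMap_eq]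
    | add p q hp hq => simp [pb_add_right, hp, hq]
    | mul_X p w hp => simp [pb_mul_right, hp, h]
  induction f using MvPolynomial.induction_on with
  | C a => simp [pb_C_left, ← algebraMap_eq]
  | add p q hp hq => simp [pb_add_left, hp, hq]
  | mul_X p w hp => simp [pb_mul_left, hp, h1]

/-! ### The height filtration -/

theorem heightGE_iff (h : Poly n K) (k : ℕ) : HeightGE h k ↔ h ∈ mm n K ^ k := by
  rw [mem_pow_idealOfVars_iff]
  rfl

theorem X_mem (v : Fin n ⊕ Fin n) : (X v : Poly n K) ∈ mm n K := Ideal.subset_span ⟨v, rfl⟩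

theorem mem_mm_iff (f : Poly n K) : f ∈ mm n K ↔ constantCoeff f = 0 := by
  constructor
  · intro h
    have : mm n K ≤ RingHom.ker (constantCoeff (σ := Fin n ⊕ Fin n) (R := K)) := by
      rw [Ideal.span_le]
      rintro _ ⟨v, rfl⟩
      simp
    exact this h
  · intro h
    rw [← pow_one (mm n K), mem_pow_idealOfVars_iff']
    intro d hd
    have : d = 0 := by
      rw [← Finsupp.degree_eq_zero_iff]; omega
    rw [this]; exact h

theorem map_mem_pow (e : Poly n K →ₐ[K] Poly n K) (he : ∀ v, e (X v) ∈ mm n K) {k : ℕ}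
    {f : Poly n K} (hf : f ∈ mm n K ^ k) : e f ∈ mm n K ^ k := by
  have h1 : (mm n K).map e ≤ mm n K := by
    rw [Ideal.map_span, Ideal.span_le]
    rintro _ ⟨_, ⟨v, rfl⟩, rfl⟩
    exact he v
  have h2 := Ideal.mem_map_of_mem e hf
  rw [Ideal.map_pow] at h2
  exact Ideal.pow_right_mono h1 k h2

theorem sub_C_mem (f : Poly n K) : f - C (constantCoeff f) ∈ mm n K := by
  rw [mem_mm_iff]; simp

theorem map_sub_mem (e : Poly n K →ₐ[K] Poly n K) (he : ∀ v, e (X v) - X v ∈ mm n K ^ 2) {k : ℕ} :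
    ∀ {f : Poly n K}, f ∈ mm n K ^ k → e f - f ∈ mm n K ^ (k + 1) := by
  have he' : ∀ v, e (X v) ∈ mm n K := fun v => by
    have := (mm n K).add_mem (Ideal.pow_le_self two_ne_zero (he v)) (X_mem v)
    simpa using this
  have h0 : ∀ f, e f - f ∈ mm n K := by
    intro f
    have h1 := sub_C_mem f
    have h2 : e (f - C (constantCoeff f)) ∈ mm n K := by
      have := map_mem_pow e he' (k := 1) (by simpa using h1)
      simpa using this
    have h3 := (mm n K).sub_mem h2 h1
    rw [← algebraMap_eq] at h3
    simpa using h3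
  have h1 : ∀ f ∈ mm n K, e f - f ∈ mm n K ^ 2 := by
    intro f hf
    induction hf using Submodule.span_induction with
    | mem x hx => obtain ⟨v, rfl⟩ := hx; exact he v
    | zero => simp
    | add x y _ _ hx hy =>
      have := (mm n K ^ 2).add_mem hx hy
      rw [map_add]; convert this using 1; ring
    | smul a x hx ihx =>
      have h2 : (e a - a) * x ∈ mm n K ^ 2 := by
        rw [pow_two]; exact Ideal.mul_mem_mul (h0 a) hx
      have := (mm n K ^ 2).add_mem ((mm n K ^ 2).mul_mem_left (e a) ihx) h2
      rw [smul_eq_mul, map_mul]; convert this using 1; ring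
  induction k with
  | zero => intro f _; simpa using h0 f
  | succ k ih =>
    intro f hf
    rw [pow_succ] at hf
    induction hf using Submodule.mul_induction_on' with
    | mem_mul_mem a ha b hb =>
      have h2 : e a * (e b - b) ∈ mm n K ^ (k + 1 + 1) := by
        rw [add_assoc, pow_add]
        exact Ideal.mul_mem_mul (map_mem_pow e he' ha) (h1 b hb)
      have h3 : (e a - a) * b ∈ mm n K ^ (k + 1 + 1) := by
        rw [pow_succ]
        exact Ideal.mul_mem_mul (ih ha) hb
      have := Ideal.add_mem _ h2 h3
      rw [map_mul]; convert this using 1; ring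
    | add x _ y _ hx hy =>
      have := Ideal.add_mem _ hx hy
      rw [map_add]; convert this using 1; ring

theorem pderiv_mem (v : Fin n ⊕ Fin n) {k : ℕ} {f : Poly n K} (hf : f ∈ mm n K ^ (k + 1)) :
    pderiv v f ∈ mm n K ^ k := by
  rw [mem_pow_idealOfVars_iff'] at hf ⊢
  intro d hd
  rw [coeff_pderiv, hf _ (by simp; omega), zero_mul]

theorem pb_mem {k l : ℕ} {f g : Poly n K} (hf : f ∈ mm n K ^ (k + 1)) (hg : g ∈ mm n K ^ (l + 1)) :
    poissonBracket f g ∈ mm n K ^ (k + l) := by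
  rw [poissonBracket, pow_add]
  refine Ideal.sum_mem _ fun i _ => Ideal.sub_mem _ ?_ ?_ <;>
  exact Ideal.mul_mem_mul (pderiv_mem _ hf) (pderiv_mem _ hg)

theorem hom_mem {k : ℕ} {f : Poly n K} (hf : f.IsHomogeneous k) : f ∈ mm n K ^ k := by
  rw [mem_pow_idealOfVars_iff']
  intro d hd
  exact hf.coeff_eq_zero hd.ne

theorem hom_eq_zero {k : ℕ} {f : Poly n K} (hf : f.IsHomogeneous k) (h : f ∈ mm n K ^ (k + 1)) :
    f = 0 := by
  ext d
  rw [mem_pow_idealOfVars_iff'] at h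
  by_cases hd : d.degree = k
  · simpa using h d (by omega)
  · simpa using hf.coeff_eq_zero hd

theorem sub_homComp_mem {k : ℕ} {f : Poly n K} (h : f ∈ mm n K ^ k) :
    f - homogeneousComponent k f ∈ mm n K ^ (k + 1) := by
  rw [mem_pow_idealOfVars_iff'] at h ⊢
  intro d hd
  rw [coeff_sub, coeff_homogeneousComponent]
  split_ifs with h1
  · simp
  · rw [h d (by omega)]; simp

/-! ### Linear forms and shears -/

/-- The linear form with coefficients `a`. -/
noncomputable def lin (a : Fin n ⊕ Fin n → K) : Poly n K := ∑ v, C (a v) * X v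

/-- The coefficient `{X v, lin b}`. -/
def J (b : Fin n ⊕ Fin n → K) (v : Fin n ⊕ Fin n) : K := sg K v * b v.swap

theorem pderiv_lin (a : Fin n ⊕ Fin n → K) (v) : pderiv v (lin a) = C (a v) := by
  classical
  simp [lin, pderiv_X, Pi.single_apply, -Fintype.sum_sum_type]

theorem lin_add (a b : Fin n ⊕ Fin n → K) : lin (a + b) = lin a + lin b := by
  simp [lin, add_mul, Finset.sum_add_distrib]

theorem lin_smul (c : K) (b : Fin n ⊕ Fin n → K) : lin (c • b) = C c * lin b := by
  simp [lin, Finset.mul_sum, mul_assoc, -Fintype.sum_sum_type]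

theorem lin_single (v : Fin n ⊕ Fin n) : lin (Pi.single v 1 : Fin n ⊕ Fin n → K) = X v := by
  simp [lin, Pi.single_apply]

theorem lin_hom (a : Fin n ⊕ Fin n → K) : (lin a).IsHomogeneous 1 :=
  IsHomogeneous.sum _ _ _ fun _ _ => isHomogeneous_C_mul_X _ _

theorem pb_X_lin (v : Fin n ⊕ Fin n) (b : Fin n ⊕ Fin n → K) :
    poissonBracket (X v) (lin b) = C (J b v) := by
  rw [pb_X_left, pderiv_lin, ← C_mul, J]

/-- The symplectic form on linear forms. -/
def om (a b : Fin n ⊕ Fin n → K) : K := ∑ v, a v * J b v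

theorem om_self (a : Fin n ⊕ Fin n → K) : om a a = 0 := by
  simp only [om, J, sg, Fintype.sum_sum_type, ← Finset.sum_add_distrib]
  refine Finset.sum_eq_zero fun i _ => ?_
  simp only [Sum.elim_inl, Sum.elim_inr, Sum.swap_inl, Sum.swap_inr]
  ring

/-- The images of the generators under a shear. -/
noncomputable def shG (b : Fin n ⊕ Fin n → K) (c : K) (d : ℕ) (v : Fin n ⊕ Fin n) : Poly n K :=
  X v + C (c * J b v) * lin b ^ d

/-- The shear homomorphism `X v ↦ X v + c (lin b)^d {X v, lin b}`. -/
noncomputable def shH (b : Fin n ⊕ Fin n → K) (c : K) (d : ℕ) : Poly n K →ₐ[K] Poly n K :=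
  aeval (shG b c d)

theorem shH_X (b : Fin n ⊕ Fin n → K) (c : K) (d : ℕ) (v) :
    shH b c d (X v) = X v + C (c * J b v) * lin b ^ d := by
  simp [shH, shG]

theorem map_C (e : Poly n K →ₐ[K] Poly n K) (c : K) : e (C c) = C c := by
  rw [← algebraMap_eq]; simp

theorem map_lin (e : Poly n K →ₐ[K] Poly n K) (a : Fin n ⊕ Fin n → K) :
    e (lin a) = ∑ v, C (a v) * e (X v) := by
  simp [lin, map_C]

theorem shH_lin (a b : Fin n ⊕ Fin n → K) (c : K) (d : ℕ) :
    shH b c d (lin a) = lin a + C (c * om a b) * lin b ^ d := by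
  rw [map_lin]
  simp only [shH_X, mul_add, Finset.sum_add_distrib]
  congr 1
  rw [om, Finset.mul_sum, map_sum, Finset.sum_mul]
  refine Finset.sum_congr rfl fun v _ => ?_
  rw [← mul_assoc, ← C_mul]; congr 2; ring

theorem shH_comp (b : Fin n ⊕ Fin n → K) (c : K) (d : ℕ) :
    (shH b c d).comp (shH b (-c) d) = AlgHom.id K _ := by
  ext1 v
  simp only [AlgHom.comp_apply, shH_X, map_add, map_mul, map_pow, map_C, shH_lin, om_self]
  simp

/-- The shear automorphism. -/
noncomputable def sh (b : Fin n ⊕ Fin n → K) (c : K) (d : ℕ) : Poly n K ≃ₐ[K] Poly n K :=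
  AlgEquiv.ofAlgHom (shH b c d) (shH b (-c) d) (shH_comp b c d)
    (by simpa using shH_comp b (-c) d)

theorem sh_apply (b : Fin n ⊕ Fin n → K) (c : K) (d : ℕ) (f) : sh b c d f = shH b c d f := rfl

theorem pb_C_mul_left (c : K) (f g : Poly n K) :
    poissonBracket (C c * f) g = C c * poissonBracket f g := by
  rw [pb_mul_left, pb_C_left]; ring

theorem pb_C_mul_right (c : K) (f g : Poly n K) :
    poissonBracket f (C c * g) = C c * poissonBracket f g := by
  rw [pb_mul_right, pb_C_right]; ring

theorem sh_pb (b : Fin n ⊕ Fin n → K) (c : K) (d : ℕ) (f g) :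
    sh b c (d + 1) (poissonBracket f g) =
      poissonBracket (sh b c (d + 1) f) (sh b c (d + 1) g) := by
  refine pb_preserve (shH b c (d + 1)) (fun v w => ?_) f g
  obtain ⟨r, hr⟩ := pb_X_X (K := K) v w
  rw [hr, map_C, shH_X, shH_X, pb_add_left, pb_add_right, pb_add_right, hr]
  simp only [pb_C_mul_left, pb_C_mul_right, pb_self]
  rw [pb_swap (lin b ^ (d + 1)) (X w), pb_pow_right, pb_pow_right, pb_X_lin, pb_X_lin]
  simp only [C_mul]
  ring

/-- The tame group, as in the theorem. -/
noncomputable abbrev G (n : ℕ) (K : Type*) [Field K] : Subgroup (Poly n K ≃ₐ[K] Poly n K) :=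
  Subgroup.closure
          {e : MvPolynomial (Fin n ⊕ Fin n) K ≃ₐ[K] MvPolynomial (Fin n ⊕ Fin n) K |
            (∀ f g, e (poissonBracket f g) = poissonBracket (e f) (e g)) ∧
            (IsLinearAut e ∨ IsOriginPresElementaryAut e)}

theorem lin_mem_span (a : Fin n ⊕ Fin n → K) :
    lin a ∈ Submodule.span K
      (Set.range (X : (Fin n ⊕ Fin n) → MvPolynomial (Fin n ⊕ Fin n) K)) := by
  refine Submodule.sum_mem _ fun v _ => ?_
  rw [← smul_eq_C_mul]
  exact Submodule.smul_mem _ _ (Submodule.subset_span ⟨v, rfl⟩)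

theorem transv_mem (b : Fin n ⊕ Fin n → K) (c : K) : sh b c 1 ∈ G n K := by
  refine Subgroup.subset_closure ⟨sh_pb b c 0, Or.inl fun v => ?_⟩
  rw [sh_apply, shH_X, ← smul_eq_C_mul, pow_one]
  exact Submodule.add_mem _ (Submodule.subset_span ⟨v, rfl⟩)
    (Submodule.smul_mem _ _ (lin_mem_span b))

theorem single_mem (v : Fin n ⊕ Fin n) (c : K) (d : ℕ) :
    sh (Pi.single v 1) c (d + 1) ∈ G n K := by
  refine Subgroup.subset_closure ⟨sh_pb _ c d, Or.inr ?_⟩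
  have hv : v ≠ v.swap := by rcases v with i | i <;> simp
  refine ⟨v.swap, 1, C (c * sg K v.swap) * X v ^ (d + 1), one_ne_zero, ?_, by simp, ?_, ?_⟩
  · rw [← smul_eq_C_mul]
    refine Subalgebra.smul_mem _ (Subalgebra.pow_mem _ ?_ _) _
    exact Algebra.subset_adjoin ⟨v, hv, rfl⟩
  · rw [sh_apply, shH_X, lin_single, J]; simp
  · intro j hj
    have : j.swap ≠ v := by rintro rfl; simp at hj
    rw [sh_apply, shH_X, J]; simp [this]

theorem sh_mem (b : Fin n ⊕ Fin n → K) (c : K) (d : ℕ) : sh b c (d + 1) ∈ G n K := by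
  by_cases hb : ∃ v, J b v ≠ 0
  · obtain ⟨v, hv⟩ := hb
    set u : Fin n ⊕ Fin n → K := b - Pi.single v 1 with hu
    have hJ : J u v = J b v := by
      have hv : v.swap ≠ v := by rcases v with i | i <;> simp
      simp [hu, J, hv]
    set g := sh u (J b v)⁻¹ 1 with hg
    have hgG : g ∈ G n K := transv_mem _ _
    have hgb : g (X v) = lin b := by
      rw [hg, sh_apply, shH_X, hJ, inv_mul_cancel₀ hv, ← lin_single v]
      rw [pow_one, C_1, one_mul, ← lin_add]; simp [hu]
    have key : sh b c (d + 1) * g = g * sh (Pi.single v 1) c (d + 1) := by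
      suffices (shH b c (d + 1)).comp (shH u (J b v)⁻¹ 1) =
          (shH u (J b v)⁻¹ 1).comp (shH (Pi.single v 1) c (d + 1)) by
        ext1 f
        exact DFunLike.congr_fun this f
      ext1 w
      have hgb' : shH u (J b v)⁻¹ 1 (X v) = lin b := hgb
      -- the image of a generator under `g` is a linear form
      have hw : ∃ a, shH u (J b v)⁻¹ 1 (X w) = lin a := by
        refine ⟨Pi.single w 1 + ((J b v)⁻¹ * J u w) • u, ?_⟩
        rw [shH_X, lin_add, lin_smul, lin_single, pow_one]
      obtain ⟨a, ha⟩ := hw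
      have h1 : (C (om a b) : Poly n K) = C (J (Pi.single v 1) w) := by
        have h2 : poissonBracket (lin a) (lin b) = C (om a b) := by
          rw [lin, om, ← neg_neg (poissonBracket _ _), ← pb_swap, ← pbD_apply, map_sum]
          simp only [pbD_apply, pb_C_mul_right]
          simp only [pb_swap (lin b), pb_X_lin]
          simp
        rw [← h2, ← ha, ← hgb']
        have h3 := sh_pb u (J b v)⁻¹ 0 (X w) (X v)
        rw [zero_add, sh_apply, sh_apply, sh_apply] at h3
        rw [← h3, ← lin_single v, pb_X_lin, map_C]
      simp only [AlgHom.comp_apply]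
      rw [ha, shH_lin, C_mul, h1, ← C_mul, shH_X, map_add, ha, map_mul (shH _ _ _), map_C,
        lin_single, map_pow, hgb']
    have : sh b c (d + 1) = g * sh (Pi.single v 1) c (d + 1) * g⁻¹ := by
      rw [← key]; simp
    rw [this]
    exact mul_mem (mul_mem hgG (single_mem v c d)) (inv_mem hgG)
  · push Not at hb
    have : sh b c (d + 1) = 1 := by
      suffices shH b c (d + 1) = AlgHom.id K _ by
        ext1 f
        exact DFunLike.congr_fun this f
      ext1 v
      rw [shH_X, hb]; simp
    rw [this]; exact one_mem _

/-! ### Powers of linear forms span -/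

theorem coeff_mem_of_forall {M : Type*} [AddCommGroup M] [Module K M] [CharZero K]
    (W : Submodule K M) (N : ℕ) (a : ℕ → M)
    (h : ∀ t : K, ∑ i ∈ Finset.range N, t ^ i • a i ∈ W) (i : ℕ) (hi : i < N) : a i ∈ W := by
  rw [← Submodule.Quotient.mk_eq_zero W, ← Module.forall_dual_apply_eq_zero_iff K]
  intro φ
  set p : Polynomial K := ∑ i ∈ Finset.range N,
    Polynomial.monomial i (φ (Submodule.Quotient.mk (a i))) with hp
  have h0 : p = 0 := by
    refine Polynomial.funext fun t => ?_
    have h1 := congrArg φ ((Submodule.Quotient.mk_eq_zero W).2 (h t))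
    rw [← Submodule.mkQ_apply, map_sum, map_sum] at h1
    simp only [map_smul, Submodule.mkQ_apply, map_zero, smul_eq_mul] at h1
    rw [hp, Polynomial.eval_finsetSum, Polynomial.eval_zero, ← h1]
    refine Finset.sum_congr rfl fun i _ => ?_
    rw [Polynomial.eval_monomial, mul_comm]
  have h2 := congrArg (fun q => q.coeff i) h0
  simpa [hp, Polynomial.finsetSum_coeff, Polynomial.coeff_monomial, hi] using h2

/-- The span of `d`-th powers of linear forms. -/
noncomputable def W (n : ℕ) (K : Type*) [Field K] (d : ℕ) : Submodule K (Poly n K) :=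
  Submodule.span K (Set.range fun a : Fin n ⊕ Fin n → K => lin a ^ d)

theorem X_mul_W [CharZero K] (d : ℕ) (v : Fin n ⊕ Fin n) (f : Poly n K) (hf : f ∈ W n K d) :
    X v * f ∈ W n K (d + 1) := by
  induction hf using Submodule.span_induction with
  | zero => simp
  | add x y _ _ hx hy => rw [mul_add]; exact add_mem hx hy
  | smul c x _ hx => rw [mul_smul_comm]; exact Submodule.smul_mem _ _ hx
  | mem x hx =>
    obtain ⟨a, rfl⟩ := hx
    have := coeff_mem_of_forall (W n K (d + 1)) (d + 1 + 1)
      (fun i => ((d + 1).choose i : K) • (X v ^ i * lin a ^ (d + 1 - i))) (fun t => ?_) 1 (by omega)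
    · simp only [pow_one, Nat.choose_one_right, Nat.add_sub_cancel] at this
      exact ((W n K (d + 1)).smul_mem_iff (Nat.cast_ne_zero.2 (Nat.succ_ne_zero d))).1 this
    · have h1 : lin (t • Pi.single v 1 + a) ^ (d + 1) ∈ W n K (d + 1) :=
        Submodule.subset_span ⟨_, rfl⟩
      rw [lin_add, lin_smul, lin_single, add_pow] at h1
      convert h1 using 2 with i
      simp only [smul_eq_C_mul, mul_pow, C_pow, map_natCast]
      ring

theorem hom_mem_W [CharZero K] (d : ℕ) (f : Poly n K) (hf : f.IsHomogeneous d) : f ∈ W n K d := by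
  have h1 : ∀ (d : ℕ) (s : Fin n ⊕ Fin n →₀ ℕ), s.degree = d → monomial s (1 : K) ∈ W n K d := by
    intro d
    induction d with
    | zero =>
      intro s hs
      rw [Finsupp.degree_eq_zero_iff] at hs
      subst hs
      refine Submodule.subset_span ⟨0, ?_⟩
      simp
    | succ d ih =>
      intro s hs
      have : s ≠ 0 := by rintro rfl; simp at hs
      obtain ⟨v, hv⟩ := Finsupp.ne_iff.1 this
      have hle : Finsupp.single v 1 ≤ s := by
        rw [Finsupp.single_le_iff]; simp at hv; omega
      obtain ⟨t, rfl⟩ := exists_add_of_le hle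
      have h2 := X_mul_W d v _ (ih t (by rw [map_add, Finsupp.degree_single] at hs; omega))
      rwa [X, monomial_mul, one_mul] at h2
  rw [f.as_sum]
  refine Submodule.sum_mem _ fun s hs => ?_
  have h2 : monomial s (coeff s f) = coeff s f • monomial s (1 : K) := by
    rw [smul_monomial]; simp
  rw [h2]
  refine Submodule.smul_mem _ _ (h1 d s ?_)
  by_contra h
  exact (mem_support_iff.1 hs) (hf.coeff_eq_zero h)

/-! ### Origin-preserving symplectomorphisms -/

/-- The group of origin-preserving symplectomorphisms. -/
def S (n : ℕ) (K : Type*) [Field K] : Subgroup (Poly n K ≃ₐ[K] Poly n K) where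
  carrier := {e | (∀ f g, e (poissonBracket f g) = poissonBracket (e f) (e g)) ∧
    ∀ f, constantCoeff (e f) = constantCoeff f}
  one_mem' := ⟨fun _ _ => rfl, fun _ => rfl⟩
  mul_mem' := by
    rintro a b ⟨ha, ha'⟩ ⟨hb, hb'⟩
    exact ⟨fun f g => by simp [hb, ha], fun f => by simp [ha', hb']⟩
  inv_mem' := by
    rintro a ⟨ha, ha'⟩
    have h : ∀ f, a (a⁻¹ f) = f := fun f => a.apply_symm_apply f
    refine ⟨fun f g => a.injective ?_, fun f => ?_⟩
    · rw [ha, h, h, h]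
    · rw [← ha', h]

theorem S_of_gens (e : Poly n K ≃ₐ[K] Poly n K)
    (h : ∀ f g, e (poissonBracket f g) = poissonBracket (e f) (e g))
    (h0 : ∀ v, constantCoeff (e (X v)) = 0) : e ∈ S n K := by
  refine ⟨h, fun f => ?_⟩
  have h1 := sub_C_mem f
  have h2 : e (f - C (constantCoeff f)) ∈ mm n K := by
    have := map_mem_pow (e : Poly n K →ₐ[K] Poly n K)
      (fun v => (mem_mm_iff _).2 (h0 v)) (k := 1) (by simpa using h1)
    simpa using this
  rw [mem_mm_iff, map_sub, map_sub, ← algebraMap_eq] at h2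
  simp only [AlgEquiv.commutes] at h2
  simpa [sub_eq_zero, algebraMap_eq] using h2

theorem S_mem_pow {e : Poly n K ≃ₐ[K] Poly n K} (he : e ∈ S n K) {k : ℕ} {f : Poly n K}
    (hf : f ∈ mm n K ^ k) : e f ∈ mm n K ^ k :=
  map_mem_pow (e : Poly n K →ₐ[K] Poly n K)
    (fun v => (mem_mm_iff _).2 (by simpa using he.2 (X v))) hf

theorem span_X_const (f : Poly n K) (hf : f ∈ Submodule.span K
      (Set.range (X : (Fin n ⊕ Fin n) → MvPolynomial (Fin n ⊕ Fin n) K))) :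
    constantCoeff f = 0 := by
  induction hf using Submodule.span_induction with
  | mem x hx => obtain ⟨v, rfl⟩ := hx; simp
  | zero => simp
  | add x y _ _ hx hy => simp [hx, hy]
  | smul a x _ hx => simp [hx, smul_eq_C_mul]

theorem G_le_S : G n K ≤ S n K := by
  rw [Subgroup.closure_le]
  rintro e ⟨he, h | h⟩
  · exact S_of_gens e he fun v => span_X_const _ (h v)
  · obtain ⟨m, a, f, -, -, hf, hm, hj⟩ := h
    refine S_of_gens e he fun v => ?_
    by_cases hv : v = m
    · subst hv; simp [hm, hf]
    · simp [hj v hv]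

/-! ### The linear part -/

/-- The linear part of an automorphism, as a homomorphism. -/
noncomputable def Lp (e : Poly n K ≃ₐ[K] Poly n K) : Poly n K →ₐ[K] Poly n K :=
  aeval fun v => homogeneousComponent 1 (e (X v))

theorem Lp_X (e : Poly n K ≃ₐ[K] Poly n K) (v) :
    Lp e (X v) = homogeneousComponent 1 (e (X v)) := by simp [Lp]

theorem hom_one_mem {f : Poly n K} (hf : f.IsHomogeneous 1) : f ∈ Submodule.span K
      (Set.range (X : (Fin n ⊕ Fin n) → MvPolynomial (Fin n ⊕ Fin n) K)) := by
  rw [← homogeneousSubmodule_one_eq_span_X]; exact hf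

theorem Lp_hom (e : Poly n K ≃ₐ[K] Poly n K) {f : Poly n K} (hf : f.IsHomogeneous 1) :
    (Lp e f).IsHomogeneous 1 := by
  have := hom_one_mem hf
  clear hf
  induction this using Submodule.span_induction with
  | mem x hx => obtain ⟨v, rfl⟩ := hx; rw [Lp_X]; exact homogeneousComponent_isHomogeneous _ _
  | zero => rw [map_zero]; exact isHomogeneous_zero _ _ _
  | add x y _ _ hx hy => rw [map_add]; exact hx.add hy
  | smul a x _ hx => rw [map_smul, smul_eq_C_mul]; exact hx.C_mul _

theorem Lp_sub {e : Poly n K ≃ₐ[K] Poly n K} (he : e ∈ S n K) {f : Poly n K}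
    (hf : f.IsHomogeneous 1) : e f - Lp e f ∈ mm n K ^ 2 := by
  have := hom_one_mem hf
  clear hf
  induction this using Submodule.span_induction with
  | mem x hx =>
    obtain ⟨v, rfl⟩ := hx; rw [Lp_X]
    refine sub_homComp_mem (k := 1) (S_mem_pow he ?_)
    simpa using X_mem v
  | zero => simp
  | add x y _ _ hx hy =>
    rw [map_add, map_add]; convert Ideal.add_mem _ hx hy using 1; ring
  | smul a x _ hx =>
    rw [map_smul, map_smul, ← smul_sub, smul_eq_C_mul]; exact Ideal.mul_mem_left _ _ hx

theorem Lp_comp {e e' : Poly n K ≃ₐ[K] Poly n K} (he : e ∈ S n K) (he' : e' ∈ S n K)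
    (h : ∀ f, e (e' f) = f) : (Lp e).comp (Lp e') = AlgHom.id K _ := by
  ext1 v
  have hX := isHomogeneous_X K v
  rw [AlgHom.comp_apply, AlgHom.id_apply, ← sub_eq_zero]
  refine hom_eq_zero (k := 1) ((Lp_hom _ (Lp_hom _ hX)).sub hX) ?_
  have h1 := S_mem_pow he (Lp_sub he' hX)
  have h2 := Lp_sub he (Lp_hom e' hX)
  rw [map_sub, h] at h1
  have := Ideal.add_mem _ h1 h2
  rw [← Ideal.neg_mem_iff]
  convert this using 1; ring

theorem step_two {σ : Poly n K ≃ₐ[K] Poly n K} (hσ : σ ∈ S n K) :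
    ∃ τ ∈ G n K, ∀ v, (τ⁻¹ * σ) (X v) - X v ∈ mm n K ^ 2 := by
  have hσ' := (S n K).inv_mem hσ
  let L : Poly n K ≃ₐ[K] Poly n K := AlgEquiv.ofAlgHom (Lp σ) (Lp σ⁻¹)
    (Lp_comp hσ hσ' fun f => σ.apply_symm_apply f)
    (Lp_comp hσ' hσ fun f => σ.symm_apply_apply f)
  have hL : ∀ f, L f = Lp σ f := fun _ => rfl
  have hLG : L ∈ G n K := by
    refine Subgroup.subset_closure ⟨?_, Or.inl fun v =>
      hom_one_mem (Lp_hom _ (isHomogeneous_X K v))⟩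
    refine pb_preserve (Lp σ) fun v w => ?_
    obtain ⟨r, hr⟩ := pb_X_X (K := K) v w
    have h1 := hσ.1 (X v) (X w)
    rw [hr, ← algebraMap_eq, AlgEquiv.commutes, algebraMap_eq] at h1
    have hv := Lp_hom σ (isHomogeneous_X K v)
    have hw := Lp_hom σ (isHomogeneous_X K w)
    rw [hr, map_C, ← sub_eq_zero]
    refine hom_eq_zero (k := 0) (IsHomogeneous.sub ?_ (isHomogeneous_C _ _)) ?_
    · refine IsHomogeneous.sum _ _ _ fun i _ => IsHomogeneous.sub ?_ ?_
      · exact (hv.pderiv.mul hw.pderiv)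
      · exact (hv.pderiv.mul hw.pderiv)
    · have h2 := pb_mem (k := 1) (l := 0) (Lp_sub hσ (isHomogeneous_X K v))
        (by simpa using hom_mem hw)
      have h3 := pb_mem (k := 0) (l := 1)
        (f := σ (X v)) (S_mem_pow hσ (by simpa using X_mem v)) (Lp_sub hσ (isHomogeneous_X K w))
      have := Ideal.add_mem _ h2 h3
      rw [pb_sub_left, pb_sub_right, ← h1] at this
      rw [← Ideal.neg_mem_iff]
      convert this using 1; ring
  refine ⟨L, hLG, fun v => ?_⟩
  have h1 := S_mem_pow (G_le_S (inv_mem hLG)) (Lp_sub hσ (isHomogeneous_X K v))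
  rw [map_sub, ← hL] at h1
  have h2 : ∀ f, L⁻¹ (L f) = f := fun f => L.symm_apply_apply f
  rw [h2] at h1
  exact h1

/-! ### The inductive step -/

theorem realize [CharZero K] {k : ℕ} (hk : 1 ≤ k) {H : Poly n K} (hH : H.IsHomogeneous (k + 2)) :
    ∃ τ ∈ G n K, ∀ v, τ (X v) - X v - poissonBracket (X v) H ∈ mm n K ^ (k + 2) := by
  have main : ∀ H ∈ W n K (k + 2), H ∈ mm n K ^ (k + 2) ∧ ∀ c : K, ∃ τ ∈ G n K,
      ∀ v, τ (X v) - X v - poissonBracket (X v) (C c * H) ∈ mm n K ^ (k + 2) := by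
    intro H hH
    induction hH using Submodule.span_induction with
    | mem x hx =>
      obtain ⟨b, rfl⟩ := hx
      refine ⟨hom_mem (by simpa using (lin_hom b).pow (k + 2)), fun c => ?_⟩
      refine ⟨sh b (c * ((k + 1 : ℕ) + 1)) (k + 1), sh_mem _ _ _, fun v => ?_⟩
      rw [sh_apply, shH_X, pb_C_mul_right, pb_pow_right, pb_X_lin]
      convert Ideal.zero_mem _ using 1
      simp only [C_mul]
      ring
    | zero =>
      refine ⟨Ideal.zero_mem _, fun c => ⟨1, one_mem _, fun v => ?_⟩⟩
      rw [mul_zero, ← C_0, pb_C_right]; simp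
    | smul a x _ hx =>
      refine ⟨by rw [smul_eq_C_mul]; exact Ideal.mul_mem_left _ _ hx.1, fun c => ?_⟩
      have := hx.2 (c * a)
      rwa [C_mul, mul_assoc, ← smul_eq_C_mul x a] at this
    | add x y _ _ hx hy =>
      refine ⟨Ideal.add_mem _ hx.1 hy.1, fun c => ?_⟩
      obtain ⟨τ₁, hτ₁, h₁⟩ := hx.2 c
      obtain ⟨τ₂, hτ₂, h₂⟩ := hy.2 c
      refine ⟨τ₁ * τ₂, mul_mem hτ₁ hτ₂, fun v => ?_⟩
      have hb : ∀ v, ∀ z ∈ mm n K ^ (k + 2), poissonBracket (X v) (C c * z) ∈ mm n K ^ (k + 1) := by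
        intro v z hz
        have := pb_mem (k := 0) (l := k + 1) (f := (X v : Poly n K)) (by simpa using X_mem v)
          (Ideal.mul_mem_left _ (C c) hz)
        rwa [zero_add] at this
      have h3 : ∀ v, τ₁ (X v) - X v ∈ mm n K ^ 2 := by
        intro v
        have h4 := Ideal.pow_le_pow_right (I := mm n K) (show 2 ≤ k + 2 by omega) (h₁ v)
        have h5 := Ideal.pow_le_pow_right (I := mm n K) (show 2 ≤ k + 1 by omega) (hb v x hx.1)
        convert Ideal.add_mem _ h4 h5 using 1; ring
      have h6 : τ₁ (poissonBracket (X v) (C c * y)) - poissonBracket (X v) (C c * y) ∈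
          mm n K ^ (k + 2) :=
        map_sub_mem (τ₁ : Poly n K →ₐ[K] Poly n K) h3 (hb v y hy.1)
      have h7 := S_mem_pow (G_le_S hτ₁) (h₂ v)
      rw [map_sub, map_sub] at h7
      have h8 := Ideal.add_mem _ (Ideal.add_mem _ h6 h7) (h₁ v)
      rw [mul_add, pb_add_right]
      convert h8 using 1
      simp only [AlgEquiv.mul_apply]
      ring
  obtain ⟨τ, hτ, h⟩ := (main H (hom_mem_W _ _ hH)).2 1
  exact ⟨τ, hτ, by simpa using h⟩

theorem poincare [CharZero K] {k : ℕ} (h : Fin n ⊕ Fin n → Poly n K)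
    (hh : ∀ v, (h v).IsHomogeneous k)
    (hc : ∀ v w, poissonBracket (X v) (h w) + poissonBracket (h v) (X w) = 0) :
    ∃ H : Poly n K, H.IsHomogeneous (k + 1) ∧ ∀ v, h v = poissonBracket (X v) H := by
  refine ⟨C ((k : K) + 1)⁻¹ * ∑ w, C (sg K w) * X w.swap * h w, ?_, fun v => ?_⟩
  · refine IsHomogeneous.C_mul (IsHomogeneous.sum _ _ _ fun w _ => ?_) _
    rw [add_comm]
    exact ((isHomogeneous_C_mul_X _ _).mul (hh w))
  have hk : ((k : K) + 1) ≠ 0 := by exact_mod_cast Nat.succ_ne_zero k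
  have h1 : ∀ w, poissonBracket (X v) (C (sg K w) * X w.swap * h w) =
      X w.swap * pderiv w.swap (h v) + (if w = v then h v else 0) := by
    intro w
    have h2 := hc v w
    rw [pb_X_right, ← sub_eq_add_neg, sub_eq_zero] at h2
    have hs : (C (sg K w) * C (sg K w) : Poly n K) = 1 := by rw [← C_mul, sg_mul_self, C_1]
    rw [mul_assoc, pb_C_mul_right, pb_mul_right, h2, pb_X_left, pderiv_X, Pi.single_apply]
    split_ifs with h3 h4 h4
    · subst h4; linear_combination (X w.swap * pderiv w.swap (h w) + h w) * hs
    · exact absurd (by simpa using congrArg Sum.swap h3) h4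
    · subst h4; simp at h3
    · linear_combination (X w.swap * pderiv w.swap (h v)) * hs
  have h2 : ∑ w, X (Sum.swap w) * pderiv (Sum.swap w) (h v) = k • h v := by
    rw [← (hh v).sum_X_mul_pderiv]
    exact Equiv.sum_comp (Equiv.sumComm (Fin n) (Fin n)) fun w => X w * pderiv w (h v)
  rw [pb_C_mul_right, ← pbD_apply, map_sum]
  simp only [pbD_apply, h1, Finset.sum_add_distrib, h2, Finset.sum_ite_eq', Finset.mem_univ, if_true]
  have h3 : k • h v + h v = C ((k : K) + 1) * h v := by simp [add_mul]
  rw [h3, ← mul_assoc, ← C_mul, inv_mul_cancel₀ hk, C_1, one_mul]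

theorem step [CharZero K] {k : ℕ} (hk : 1 ≤ k) {σ : Poly n K ≃ₐ[K] Poly n K} (hσ : σ ∈ S n K)
    (h : ∀ v, σ (X v) - X v ∈ mm n K ^ (k + 1)) :
    ∃ τ ∈ G n K, ∀ v, (τ⁻¹ * σ) (X v) - X v ∈ mm n K ^ (k + 2) := by
  obtain ⟨H, hH, hHv⟩ := poincare (k := k + 1)
    (fun v => homogeneousComponent (k + 1) (σ (X v) - X v))
    (fun v => homogeneousComponent_isHomogeneous _ _) (by
      intro v w
      have hv := homogeneousComponent_isHomogeneous (k + 1) (σ (X v) - X v)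
      have hw := homogeneousComponent_isHomogeneous (k + 1) (σ (X w) - X w)
      have rv := sub_homComp_mem (h v)
      have rw' := sub_homComp_mem (h w)
      generalize homogeneousComponent (k + 1) (σ (X v) - X v) = a at *
      generalize homogeneousComponent (k + 1) (σ (X w) - X w) = b at *
      refine hom_eq_zero (k := k) (IsHomogeneous.add ?_ ?_) ?_
      · rw [pb_X_left]; exact hw.pderiv.C_mul _
      · rw [pb_X_right]; exact (hv.pderiv.C_mul _).neg
      · obtain ⟨r, hr⟩ := pb_X_X (K := K) v w
        have h1 := hσ.1 (X v) (X w)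
        rw [hr, ← algebraMap_eq, AlgEquiv.commutes, algebraMap_eq, ← hr] at h1
        have h2 := Ideal.pow_le_pow_right (I := mm n K) (show k + 1 ≤ k + k by omega)
          (pb_mem (h v) (h w))
        have h3 := pb_mem (k := 0) (l := k + 1) (f := (X v : Poly n K)) (by simpa using X_mem v) rw'
        have h4 := pb_mem (k := k + 1) (l := 0) (g := (X w : Poly n K)) rv (by simpa using X_mem w)
        rw [zero_add] at h3
        rw [add_zero] at h4
        have h5 := Ideal.add_mem _ h2 (Ideal.add_mem _ h3 h4)
        rw [← Ideal.neg_mem_iff]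
        convert h5 using 1
        simp only [pb_sub_left, pb_sub_right]
        rw [← h1]
        ring)
  obtain ⟨τ, hτ, hτv⟩ := realize hk hH
  refine ⟨τ, hτ, fun v => ?_⟩
  have h1 : σ (X v) - τ (X v) ∈ mm n K ^ (k + 2) := by
    have h2 := sub_homComp_mem (h v)
    have h3 := hHv v
    rw [h3] at h2
    convert Ideal.sub_mem _ h2 (hτv v) using 1
    ring
  have h4 := S_mem_pow (G_le_S (inv_mem hτ)) h1
  have h5 : ∀ f, τ⁻¹ (τ f) = f := fun f => τ.symm_apply_apply f
  rw [map_sub, h5] at h4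
  exact h4

theorem all_steps [CharZero K] {σ : Poly n K ≃ₐ[K] Poly n K} (hσ : σ ∈ S n K) (k : ℕ) :
    ∃ τ ∈ G n K, ∀ v, (τ⁻¹ * σ) (X v) - X v ∈ mm n K ^ (k + 2) := by
  induction k with
  | zero => exact step_two hσ
  | succ k ih =>
    obtain ⟨τ, hτ, h⟩ := ih
    obtain ⟨τ', hτ', h'⟩ := step (k := k + 1) (by omega)
      (mul_mem (inv_mem (G_le_S hτ)) hσ) h
    refine ⟨τ * τ', mul_mem hτ hτ', fun v => ?_⟩
    rw [mul_inv_rev, mul_assoc]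
    exact h' v

end TameSymp

/-- **Tame approximation of symplectomorphisms.** Let `K` have characteristic zero,
and let `σ` be an origin-preserving automorphism of `K[x_1,…,x_n,p_1,…,p_n]` that
preserves the canonical Poisson bracket. Then for every `k` there is a tame
symplectomorphism `τ` (in the subgroup generated by bracket-preserving automorphisms
that are linear or origin-preserving elementary) such that `(τ⁻¹ ∘ σ)(ξ) − ξ` has
height `≥ k` for every generator `ξ`. -/
theorem tame_approximation_of_symplectomorphisms (K : Type*) [Field K] [CharZero K]
    (n : ℕ) (hn : 1 ≤ n)
    (σ : MvPolynomial (Fin n ⊕ Fin n) K ≃ₐ[K] MvPolynomial (Fin n ⊕ Fin n) K)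
    (hσpb : ∀ f g, σ (poissonBracket f g) = poissonBracket (σ f) (σ g))
    (hσ0 : ∀ v : Fin n ⊕ Fin n, constantCoeff (σ (X v)) = 0) :
    ∀ k : ℕ,
      ∃ τ ∈ Subgroup.closure
          {e : MvPolynomial (Fin n ⊕ Fin n) K ≃ₐ[K] MvPolynomial (Fin n ⊕ Fin n) K |
            (∀ f g, e (poissonBracket f g) = poissonBracket (e f) (e g)) ∧
            (IsLinearAut e ∨ IsOriginPresElementaryAut e)},
        ∀ v : Fin n ⊕ Fin n, HeightGE ((τ⁻¹ * σ) (X v) - X v) k := by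
  intro k
  obtain ⟨τ, hτ, h⟩ := TameSymp.all_steps (TameSymp.S_of_gens σ hσpb hσ0) k
  refine ⟨τ, hτ, fun v => ?_⟩
  rw [TameSymp.heightGE_iff]
  exact Ideal.pow_le_pow_right (by omega) (h v)
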